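/- arXiv:2602.13380 — 5 statements merged into one kernel-verified Lean document; each statement's English description precedes it below -/
import Mathlib

section
/- Let n ≥ 2, let Z be a strictly increasing finite sequence z_1 < z_2 < … < z_n of real numbers, let α ∈ [0,1), and let c be a real number. If F_Z⁻¹(1−α) ≤ c, then the number of indices i ∈ {1,…,n} with z_i > c is at most (n−1) − ⌊(1−α)(n−1)⌋. (This makes precise the claim that enforcing the empirical (1−α)-quantile constraint F_Z⁻¹(1−α) ≤ 0 allows the requirement value to be positive for only a small fraction of the scenarios.) -/
/-- `F` is the piecewise-linear empirical CDF of the strictly increasing sequence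
`z_0 < z_1 < … < z_{n+1}` (a sequence of length `n+2 ≥ 2`, written 0-indexed; the paper's
`1/(n-1)` factor for a length-`n` sequence becomes `1/(n+1)` here):
`F x = 0` for `x ≤ z_0`; `F x = 1` for `x > z_{n+1}`; and
`F x = (1/(n+1))·(i + (x − z_i)/(z_{i+1} − z_i))` for `z_i < x ≤ z_{i+1}`. -/
def IsEmpCDF {n : ℕ} (z : Fin (n + 2) → ℝ) (F : ℝ → ℝ) : Prop :=
  (∀ x : ℝ, x ≤ z 0 → F x = 0) ∧
  (∀ x : ℝ, z (Fin.last (n + 1)) < x → F x = 1) ∧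
  (∀ (i : Fin (n + 1)) (x : ℝ), z i.castSucc < x → x ≤ z i.succ →
    F x = ((n : ℝ) + 1)⁻¹ * ((i.1 : ℝ) + (x - z i.castSucc) / (z i.succ - z i.castSucc)))

/-- `Q` is the inverse piecewise-linear empirical CDF of the strictly increasing sequence
`z_0 < z_1 < … < z_{n+1}`: `Q 0 = z_0`, `Q 1 = z_{n+1}`, and for `0 < α < 1`,
`Q α = z_i + (z_{i+1} − z_i)·((n+1)α − i)` where `i = ⌊(n+1)α⌋` (the unique `i` with
`i ≤ (n+1)α < i+1`). -/
def IsEmpQuantile {n : ℕ} (z : Fin (n + 2) → ℝ) (Q : ℝ → ℝ) : Prop :=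
  Q 0 = z 0 ∧ Q 1 = z (Fin.last (n + 1)) ∧
  ∀ α : ℝ, 0 < α → α < 1 → ∀ i : Fin (n + 1),
    (i.1 : ℝ) ≤ ((n : ℝ) + 1) * α → ((n : ℝ) + 1) * α < (i.1 : ℝ) + 1 →
      Q α = z i.castSucc + (z i.succ - z i.castSucc) * (((n : ℝ) + 1) * α - (i.1 : ℝ))

/-- The quantile at level `p` dominates the sequence entry of index `⌊p (n+1)⌋`. -/
theorem IsEmpQuantile.apply_floor_le {n : ℕ} {z : Fin (n + 2) → ℝ} (hz : StrictMono z)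
    {Q : ℝ → ℝ} (hQ : IsEmpQuantile z Q) {p : ℝ} (hp0 : 0 < p) (hp1 : p ≤ 1)
    (k : Fin (n + 2)) (hk : k.1 = ⌊p * ((n : ℝ) + 1)⌋₊) : z k ≤ Q p := by
  obtain ⟨-, hQ1, hQi⟩ := hQ
  rcases hp1.eq_or_lt with rfl | hp1
  · rw [hQ1]
    exact hz.monotone (Fin.le_last k)
  · have hlo : (k.1 : ℝ) ≤ (n + 1) * p := by
      rw [hk, mul_comm]
      exact Nat.floor_le (by positivity)
    have hhi : ((n : ℝ) + 1) * p < k.1 + 1 := by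
      rw [hk, mul_comm]
      exact Nat.lt_floor_add_one _
    have hlt : k.1 < n + 1 := by
      have : (k.1 : ℝ) < n + 1 := by nlinarith
      exact_mod_cast this
    rw [hQi p hp0 hp1 ⟨k.1, hlt⟩ hlo hhi]
    have hstep := hz (Fin.castSucc_lt_succ (i := (⟨k.1, hlt⟩ : Fin (n + 1))))
    exact le_add_of_nonneg_right (mul_nonneg (sub_nonneg.2 hstep.le) (sub_nonneg.2 hlo))

/-- if `α ∈ [0,1)` and `F⁻¹(1−α) ≤ c`, then the number of indices `i` with
`z_i > c` is at most `(n+1) − ⌊(1−α)(n+1)⌋` (the sequence has length `n+2`, so `n+1` plays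
the role of the paper's `n−1`). -/
theorem stmt5 {n : ℕ} (z : Fin (n + 2) → ℝ) (hz : StrictMono z)
    (Q : ℝ → ℝ) (hQ : IsEmpQuantile z Q)
    (α : ℝ) (hα0 : 0 ≤ α) (hα1 : α < 1) (c : ℝ) (hc : Q (1 - α) ≤ c) :
    {i : Fin (n + 2) | c < z i}.ncard ≤ (n + 1) - ⌊(1 - α) * ((n : ℝ) + 1)⌋₊ := by
  have hle : ⌊(1 - α) * ((n : ℝ) + 1)⌋₊ ≤ n + 1 := by
    refine Nat.floor_le_of_le ?_
    push_cast
    nlinarith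
  let k : Fin (n + 2) := ⟨⌊(1 - α) * ((n : ℝ) + 1)⌋₊, by omega⟩
  have hk : z k ≤ c :=
    (hQ.apply_floor_le hz (sub_pos.2 hα1) (sub_le_self 1 hα0) k rfl).trans hc
  have hsub : {i | c < z i} ⊆ (Finset.Ioi k : Set (Fin (n + 2))) := fun i hi =>
    Finset.mem_coe.2 (Finset.mem_Ioi.2 (hz.lt_iff_lt.1 (hk.trans_lt hi)))
  calc {i | c < z i}.ncard ≤ (Finset.Ioi k : Set (Fin (n + 2))).ncard :=
        Set.ncard_le_ncard hsub (Finset.finite_toSet _)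
    _ = (n + 1) - ⌊(1 - α) * ((n : ℝ) + 1)⌋₊ := by
        rw [Set.ncard_coe_finset, Fin.card_Ioi]
        simp only [k]
        omega
end

section
/- Let n ≥ 2 and let Z be a strictly increasing finite sequence z_1 < z_2 < … < z_n of real numbers with z_1 < 0 < z_n and z_i ≠ 0 for every i. Let p be the number of indices i with z_i > 0. Then p − 1 < (n−1)·(1 − F_Z(0)) < p; that is, the empirical failure probability 1 − F_Z(0) computed from the piecewise-linear empirical CDF differs from the empirical fraction of positive values by less than one scenario weight 1/(n−1). -/
theorem exists_castSucc_neg_succ_pos {n : ℕ} (z : Fin (n + 2) → ℝ)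
    (h0 : z 0 < 0) (h1 : 0 < z (Fin.last (n + 1))) (hne : ∀ i, z i ≠ 0) :
    ∃ i : Fin (n + 1), z i.castSucc < 0 ∧ 0 < z i.succ := by
  by_contra! h
  have hneg : ∀ j, z j < 0 := fun j =>
    Fin.induction (motive := fun j => z j < 0) h0
      (fun i hi => lt_of_le_of_ne (h i hi) (hne _)) j
  exact lt_asymm h1 (hneg _)

theorem ncard_setOf_pos_of_strictMono {n : ℕ} {z : Fin (n + 2) → ℝ} (hz : StrictMono z)
    {i : Fin (n + 1)} (hneg : z i.castSucc < 0) (hpos : 0 < z i.succ) :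
    {j : Fin (n + 2) | 0 < z j}.ncard = n + 1 - i := by
  have hset : {j : Fin (n + 2) | 0 < z j} = (Finset.Ioi i.castSucc : Finset (Fin (n + 2))) := by
    ext j
    simp only [Set.mem_ofPred_eq, Finset.coe_Ioi, Set.mem_Ioi]
    exact ⟨fun hj => hz.lt_iff_lt.1 (hneg.trans hj),
      fun hj => hpos.trans_le (hz.monotone (Fin.castSucc_lt_iff_succ_le.1 hj))⟩
  rw [hset, Set.ncard_coe_finset, Fin.card_Ioi, Fin.val_castSucc]
  omega

/-- if `z_0 < 0 < z_{n+1}` and no `z_i` is zero, and `p` is the number of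
indices with `z_i > 0`, then `p − 1 < (n+1)·(1 − F 0) < p`: the empirical failure
probability `1 − F 0` differs from the empirical fraction of positive values by less than
one scenario weight `1/(n+1)`. -/
theorem stmt7 {n : ℕ} (z : Fin (n + 2) → ℝ) (hz : StrictMono z)
    (F : ℝ → ℝ) (hF : IsEmpCDF z F)
    (h0 : z 0 < 0) (h1 : 0 < z (Fin.last (n + 1))) (hne : ∀ i, z i ≠ 0) :
    ({i : Fin (n + 2) | 0 < z i}.ncard : ℝ) - 1 < ((n : ℝ) + 1) * (1 - F 0) ∧
    ((n : ℝ) + 1) * (1 - F 0) < ({i : Fin (n + 2) | 0 < z i}.ncard : ℝ) := by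
  obtain ⟨i, hneg, hpos⟩ := exists_castSucc_neg_succ_pos z h0 h1 hne
  rw [ncard_setOf_pos_of_strictMono hz hneg hpos, hF.2.2 i 0 hneg hpos.le,
    Nat.cast_sub i.isLt.le]
  have hgap : 0 < z i.succ - z i.castSucc := by linarith
  have ht0 : 0 < (0 - z i.castSucc) / (z i.succ - z i.castSucc) :=
    div_pos (by linarith) hgap
  have ht1 : (0 - z i.castSucc) / (z i.succ - z i.castSucc) < 1 := by
    rw [div_lt_one hgap]
    linarith
  have hn : (n : ℝ) + 1 ≠ 0 := by positivity
  rw [mul_sub, mul_inv_cancel_left₀ hn]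
  push_cast
  constructor <;> linarith
end

section
/- Let Θ ⊆ ℝ^m be open, let n ≥ 2, and let z_1(θ), …, z_n(θ) be real-valued functions of θ ∈ Θ, each continuously differentiable on Θ. Fix θ₀ ∈ Θ such that the n values z_1(θ₀), …, z_n(θ₀) are pairwise distinct, and fix a level c ∈ ℝ with c ≠ z_i(θ₀) for every i. Let Z(θ) denote the sequence z_1(θ),…,z_n(θ) sorted in increasing order. Then the map θ ↦ F_{Z(θ)}(c) is continuously differentiable in a neighborhood of θ₀. -/
theorem exists_castSucc_lt_lt_succ {α : Type*} [LinearOrder α] {n : ℕ} (w : Fin (n + 1) → α)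
    (c : α) (hc : ∀ i, c ≠ w i) (h0 : w 0 < c) (hlast : c < w (Fin.last n)) :
    ∃ i : Fin n, w i.castSucc < c ∧ c < w i.succ := by
  by_contra! h
  have hlt : ∀ i, w i < c := by
    intro i
    induction i using Fin.induction with
    | zero => exact h0
    | succ i ih => exact (h i ih).lt_of_ne (hc _).symm
  exact (hlt _).not_gt hlast

theorem sort_eq_of_strictMono_comp {α : Type*} [LinearOrder α] {n : ℕ} {f : Fin n → α}
    {σ : Equiv.Perm (Fin n)} (h : StrictMono (f ∘ σ)) : Tuple.sort f = σ :=
  (Tuple.eq_sort_iff.2 ⟨h.monotone, fun _ _ hij heq => absurd heq (h hij).ne⟩).symm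

/-- let `Θs ⊆ ℝ^m` be open and let `z_0(θ),…,z_{n+1}(θ)` be continuously
differentiable on `Θs`. Fix `θ₀ ∈ Θs` at which the `n+2` values are pairwise distinct and a
level `c` different from every `z_i(θ₀)`. If `F w` is the piecewise-linear empirical CDF of
every strictly increasing tuple `w`, then `θ ↦ F_{Z(θ)}(c)` — where `Z(θ)` is the tuple
`z_0(θ),…,z_{n+1}(θ)` sorted increasingly via `Tuple.sort` — is continuously differentiable
on a neighborhood of `θ₀`. -/
theorem stmt10 {m n : ℕ} (Θs : Set (EuclideanSpace ℝ (Fin m))) (hΘ : IsOpen Θs)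
    (zf : Fin (n + 2) → EuclideanSpace ℝ (Fin m) → ℝ)
    (hzf : ∀ i, ContDiffOn ℝ 1 (zf i) Θs)
    (θ₀ : EuclideanSpace ℝ (Fin m)) (hθ₀ : θ₀ ∈ Θs)
    (hdist : Function.Injective (fun i => zf i θ₀))
    (c : ℝ) (hc : ∀ i, c ≠ zf i θ₀)
    (F : (Fin (n + 2) → ℝ) → ℝ → ℝ)
    (hF : ∀ w : Fin (n + 2) → ℝ, StrictMono w → IsEmpCDF w (F w)) :
    ∃ U : Set (EuclideanSpace ℝ (Fin m)), IsOpen U ∧ θ₀ ∈ U ∧ U ⊆ Θs ∧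
      ContDiffOn ℝ 1
        (fun θ => F (fun i => zf (Tuple.sort (fun j => zf j θ) i) θ) c) U := by
  set σ := Tuple.sort (fun j => zf j θ₀)
  have hmono : StrictMono fun i => zf (σ i) θ₀ :=
    (Tuple.monotone_sort fun j => zf j θ₀).strictMono_of_injective (hdist.comp σ.injective)
  have hcont : ∀ i, ContinuousAt (zf i) θ₀ := fun i =>
    (hzf i).continuousOn.continuousAt (hΘ.mem_nhds hθ₀)
  have hsorted : ∀ᶠ θ in nhds θ₀, StrictMono fun i => zf (σ i) θ := by
    have : ∀ᶠ θ in nhds θ₀, ∀ i j, i < j → zf (σ i) θ < zf (σ j) θ := by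
      simp only [Filter.eventually_all]
      exact fun i j hij => (hcont _).eventually_lt (hcont _) (hmono hij)
    exact this.mono fun θ h i j hij => h i j hij
  suffices h : ∃ g : EuclideanSpace ℝ (Fin m) → ℝ, ∀ᶠ θ in nhds θ₀,
      F (fun i => zf (σ i) θ) c = g θ ∧ ContDiffAt ℝ 1 g θ by
    obtain ⟨g, hg⟩ := h
    obtain ⟨U, hU, hUo, hmem⟩ :=
      mem_nhds_iff.1 ((hg.and hsorted).and (hΘ.mem_nhds hθ₀))
    refine ⟨U, hUo, hmem, fun θ hθ => (hU hθ).2, ?_⟩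
    have hgU : ContDiffOn ℝ 1 g U := fun θ hθ => (hU hθ).1.1.2.contDiffWithinAt
    refine hgU.congr fun θ hθ => ?_
    obtain ⟨⟨⟨hFg, -⟩, hs⟩, -⟩ := hU hθ
    rw [sort_eq_of_strictMono_comp (f := fun j => zf j θ) hs, hFg]
  have hgt : ∀ i, c < zf i θ₀ → ∀ᶠ θ in nhds θ₀, c < zf i θ := fun i h =>
    (hcont i).eventually_const_lt h
  have hlt : ∀ i, zf i θ₀ < c → ∀ᶠ θ in nhds θ₀, zf i θ < c := fun i h =>
    (hcont i).eventually_lt_const h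
  rcases (hc (σ 0)).lt_or_gt with h0 | h0
  · refine ⟨fun _ => 0, ?_⟩
    filter_upwards [hsorted, hgt _ h0] with θ hs h
    exact ⟨(hF _ hs).1 c h.le, contDiffAt_const⟩
  rcases (hc (σ (Fin.last (n + 1)))).lt_or_gt with h1 | h1
  · obtain ⟨i, hi, hi'⟩ := exists_castSucc_lt_lt_succ (fun i => zf (σ i) θ₀) c
      (fun i => hc _) h0 h1
    refine ⟨fun θ => ((n : ℝ) + 1)⁻¹ * ((i.1 : ℝ) + (c - zf (σ i.castSucc) θ) /
      (zf (σ i.succ) θ - zf (σ i.castSucc) θ)), ?_⟩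
    filter_upwards [hsorted, hlt _ hi, hgt _ hi', hΘ.mem_nhds hθ₀] with θ hs h h' hθ
    have hz : ∀ j, ContDiffAt ℝ 1 (zf j) θ := fun j => (hzf j).contDiffAt (hΘ.mem_nhds hθ)
    exact ⟨(hF _ hs).2.2 i c h h'.le, contDiffAt_const.mul <| contDiffAt_const.add <|
      (contDiffAt_const.sub (hz _)).div ((hz _).sub (hz _)) (sub_pos.2 (h.trans h')).ne'⟩
  · refine ⟨fun _ => 1, ?_⟩
    filter_upwards [hsorted, hlt _ h1] with θ hs h
    exact ⟨(hF _ hs).2.1 c h, contDiffAt_const⟩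
end

section
/- Let J : ℝ^d → ℝ be convex and let f_1, …, f_N : ℝ^d → ℝ be convex. Assume that for every subset I ⊆ {1,…,N}, the program min J(θ) subject to f_j(θ) ≤ 0 for all j ∈ I admits a unique minimizer θ*_I ∈ ℝ^d. Call the i-th constraint a support constraint of the full problem if θ*_{{1,…,N}∖{i}} ≠ θ*_{{1,…,N}}. Then the number of support constraints is at most d, the dimension of the decision variable. -/
/-- let `J` and `f_1,…,f_N` be convex on `ℝ^d` and suppose that for every
subset `I ⊆ {1,…,N}` the program `min J(θ) s.t. f_j(θ) ≤ 0 ∀ j ∈ I` admits the unique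
minimizer `θstar I` (it is feasible, optimal, and every minimizer coincides with it). Call
constraint `i` a support constraint if removing it changes the optimizer,
`θstar (univ \ {i}) ≠ θstar univ`. Then the number of support constraints is at most `d`,
the dimension of the decision variable. -/
theorem stmt14 {d N : ℕ} (J : (Fin d → ℝ) → ℝ) (hJ : ConvexOn ℝ Set.univ J)
    (f : Fin N → (Fin d → ℝ) → ℝ) (hf : ∀ j, ConvexOn ℝ Set.univ (f j))
    (θstar : Finset (Fin N) → (Fin d → ℝ))
    (hfeas : ∀ I : Finset (Fin N), ∀ j ∈ I, f j (θstar I) ≤ 0)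
    (hopt : ∀ I : Finset (Fin N), ∀ θ : Fin d → ℝ, (∀ j ∈ I, f j θ ≤ 0) →
      J (θstar I) ≤ J θ)
    (huniq : ∀ I : Finset (Fin N), ∀ θ : Fin d → ℝ, (∀ j ∈ I, f j θ ≤ 0) →
      (∀ θ' : Fin d → ℝ, (∀ j ∈ I, f j θ' ≤ 0) → J θ ≤ J θ') → θ = θstar I) :
    {i : Fin N | θstar (Finset.univ.erase i) ≠ θstar Finset.univ}.ncard ≤ d := by
  classical
  let F : Option (Fin N) → Set (Fin d → ℝ) := fun o ↦
    o.elim {θ | J θ < J (θstar Finset.univ)} fun i ↦ {θ | f i θ ≤ 0}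
  have lt_of_support : ∀ i, θstar (Finset.univ.erase i) ≠ θstar Finset.univ →
      J (θstar (Finset.univ.erase i)) < J (θstar Finset.univ) := by
    intro i hi
    by_contra! hle
    exact hi (huniq _ _ (fun j _ ↦ hfeas _ j (Finset.mem_univ j))
      fun θ' hθ' ↦ hle.trans (hopt _ θ' hθ')).symm
  by_contra! hcard
  obtain ⟨θ, hθ⟩ : (⋂ o ∈ (Finset.univ : Finset (Option (Fin N))), F o).Nonempty := by
    refine Convex.helly_theorem' (𝕜 := ℝ) ?_ ?_
    · rintro (_ | i) -
      · simpa [F] using hJ.convex_lt (J (θstar Finset.univ))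
      · simpa [F] using (hf i).convex_le 0
    · intro I _ hI
      by_cases hnone : none ∈ I
      · have hsmall : I.eraseNone.card ≤ d := by
          rw [Finset.card_eraseNone_of_mem hnone]
          simp only [Module.finrank_fin_fun] at hI
          omega
        obtain ⟨i, hi, hiI⟩ := Set.exists_mem_notMem_of_ncard_lt_ncard
          (s := (I.eraseNone : Set (Fin N)))
          (t := {i | θstar (Finset.univ.erase i) ≠ θstar Finset.univ}) (by
            rw [Set.ncard_coe_finset]
            exact hsmall.trans_lt hcard)
        refine ⟨θstar (Finset.univ.erase i), Set.mem_iInter₂.2 ?_⟩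
        rintro (_ | j) hj
        · exact lt_of_support i hi
        · refine hfeas _ j (Finset.mem_erase.2 ⟨?_, Finset.mem_univ j⟩)
          rintro rfl
          exact hiI (Finset.mem_coe.2 (Finset.mem_eraseNone.2 hj))
      · refine ⟨θstar Finset.univ, Set.mem_iInter₂.2 ?_⟩
        rintro (_ | j) hj
        · exact absurd hj hnone
        · exact hfeas _ j (Finset.mem_univ j)
  rw [Set.mem_iInter₂] at hθ
  exact (hopt _ θ fun j _ ↦ hθ (some j) (Finset.mem_univ _)).not_gt
    (hθ none (Finset.mem_univ _))
end

section
/- Let n ≥ 1 be an integer, let k ∈ {0, 1, …, n−1}, and let β ∈ (0,1). Define the polynomial g(t) = C(n,k)·t^{n−k} − (β/(2n))·Σ_{i=k}^{n−1} C(i,k)·t^{i−k} − (β/(6n))·Σ_{i=n+1}^{4n} C(i,k)·t^{i−k}, where C(m,k) denotes the binomial coefficient. Then g has exactly two roots in [0, +∞), denoted t̲(k) ≤ t̄(k). -/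
/-- The polynomial of the scenario risk bound:
`g(t) = C(n,k)·t^{n−k} − (β/(2n))·Σ_{i=k}^{n−1} C(i,k)·t^{i−k}
        − (β/(6n))·Σ_{i=n+1}^{4n} C(i,k)·t^{i−k}`. -/
noncomputable def gpoly (n k : ℕ) (β : ℝ) (t : ℝ) : ℝ :=
  (n.choose k : ℝ) * t ^ (n - k)
    - (β / (2 * (n : ℝ))) * ∑ i ∈ Finset.Icc k (n - 1), (i.choose k : ℝ) * t ^ (i - k)
    - (β / (6 * (n : ℝ))) * ∑ i ∈ Finset.Icc (n + 1) (4 * n), (i.choose k : ℝ) * t ^ (i - k)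

/-- A nonnegative combination of integer powers is convex on the positive half-line. -/
theorem convexOn_sum_mul_zpow {ι : Type*} (s : Finset ι) (c : ι → ℝ) (m : ι → ℤ)
    (hc : ∀ i ∈ s, 0 ≤ c i) :
    ConvexOn ℝ (Set.Ioi 0) (fun t : ℝ => ∑ i ∈ s, c i * t ^ m i) := by
  classical
  induction s using Finset.induction_on with
  | empty => simpa using convexOn_const (0 : ℝ) (convex_Ioi (0 : ℝ))
  | insert a s ha ih =>
    simp only [Finset.sum_insert ha]
    exact ((convexOn_zpow (m a)).smul (hc a (by simp))).add
      (ih fun i hi => hc i (by simp [hi]))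

/-- A nonnegative combination of integer powers with a strictly convex term is strictly convex
on the positive half-line. -/
theorem strictConvexOn_sum_mul_zpow {ι : Type*} (s : Finset ι) (c : ι → ℝ) (m : ι → ℤ)
    (hc : ∀ i ∈ s, 0 ≤ c i) {j : ι} (hj : j ∈ s) (hcj : 0 < c j) (h0 : m j ≠ 0) (h1 : m j ≠ 1) :
    StrictConvexOn ℝ (Set.Ioi 0) (fun t : ℝ => ∑ i ∈ s, c i * t ^ m i) := by
  classical
  simp only [← Finset.add_sum_erase s _ hj]
  have hj' : StrictConvexOn ℝ (Set.Ioi 0) (fun t : ℝ => c j * t ^ m j) := by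
    refine ⟨convex_Ioi 0, fun x hx y hy hxy a b ha hb hab => ?_⟩
    have h := mul_lt_mul_of_pos_left ((strictConvexOn_zpow h0 h1).2 hx hy hxy ha hb hab) hcj
    simp only [smul_eq_mul] at h ⊢
    linarith
  exact hj'.add_convexOn
    (convexOn_sum_mul_zpow _ c m fun i hi => hc i (Finset.mem_of_mem_erase hi))

/-- A strictly convex function takes the same value at no three points `a < b < c`. -/
theorem StrictConvexOn.not_eq_of_lt_of_lt {s : Set ℝ} {f : ℝ → ℝ} (hf : StrictConvexOn ℝ s f)
    {a b c y : ℝ} (ha : a ∈ s) (hc : c ∈ s) (hab : a < b) (hbc : b < c)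
    (hfa : f a = y) (hfb : f b = y) (hfc : f c = y) : False := by
  have h := hf.lt_on_openSegment ha hc (hab.trans hbc).ne
    (by rw [openSegment_eq_Ioo (hab.trans hbc)]; exact ⟨hab, hbc⟩)
  simp [hfa, hfb, hfc] at h

/-- At `t = (n - k) / n`, the sequence `i ↦ C(i,k) t^(i-k)` is maximal at `i = n`. -/
theorem choose_mul_pow_le {n k : ℕ} (hkn : k < n) {i : ℕ} (hki : k ≤ i) :
    (i.choose k : ℝ) * (((n : ℝ) - k) / n) ^ (i - k)
      ≤ (n.choose k : ℝ) * (((n : ℝ) - k) / n) ^ (n - k) := by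
  have hn : (0 : ℝ) < n := by exact_mod_cast (by omega : 0 < n)
  have hkn' : (k : ℝ) < n := by exact_mod_cast hkn
  set t : ℝ := ((n : ℝ) - k) / n with ht
  have ht0 : 0 < t := div_pos (by linarith) hn
  have htn : t * n = n - k := by rw [ht]; field_simp
  have key (j : ℕ) (hkj : k ≤ j) :
      (j.choose k : ℝ) * (j + 1) = ((j + 1).choose k : ℝ) * (j + 1 - k) := by
    have h := Nat.choose_mul_succ_eq j k
    have h' : (((j + 1 - k : ℕ) : ℝ)) = j + 1 - k := by
      rw [Nat.cast_sub (by omega)]; push_cast; ring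
    rw [← h']; exact_mod_cast h
  have hsucc (j : ℕ) (hkj : k ≤ j) :
      ((j + 1).choose k : ℝ) * t ^ (j + 1 - k) = ((j + 1).choose k : ℝ) * t * t ^ (j - k) := by
    rw [Nat.sub_add_comm hkj, pow_succ]; ring
  have hk0 : (0 : ℝ) ≤ k := Nat.cast_nonneg k
  rcases le_total i n with hin | hni
  · refine Nat.decreasingInduction' (P := fun j => (j.choose k : ℝ) * t ^ (j - k)
      ≤ (n.choose k : ℝ) * t ^ (n - k)) (fun j hjn hij ih => le_trans ?_ ih) hin le_rfl
    have hkj : k ≤ j := hki.trans hij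
    rw [hsucc j hkj]
    refine mul_le_mul_of_nonneg_right ?_ (by positivity)
    have hj : (j : ℝ) + 1 ≤ n := by exact_mod_cast hjn
    have hle : (j : ℝ) + 1 - k ≤ t * (j + 1) := by
      rw [ht, div_mul_eq_mul_div, le_div_iff₀ hn]
      nlinarith
    refine le_of_mul_le_mul_right ?_ (by positivity : (0 : ℝ) < j + 1)
    rw [key j hkj, mul_assoc]
    exact mul_le_mul_of_nonneg_left hle (by positivity)
  · induction i, hni using Nat.le_induction with
    | base => exact le_rfl
    | succ j hnj ih =>
      have hkj : k ≤ j := hkn.le.trans hnj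
      refine le_trans ?_ (ih hkj)
      rw [hsucc j hkj]
      refine mul_le_mul_of_nonneg_right ?_ (by positivity)
      have hj : (n : ℝ) ≤ j := by exact_mod_cast hnj
      have hle : t * (j + 1) ≤ (j : ℝ) + 1 - k := by
        rw [ht, div_mul_eq_mul_div, div_le_iff₀ hn]
        nlinarith
      refine le_of_mul_le_mul_right ?_ (by positivity : (0 : ℝ) < j + 1)
      rw [key j hkj, mul_assoc]
      exact mul_le_mul_of_nonneg_left hle (by positivity)

theorem continuous_gpoly (n k : ℕ) (β : ℝ) : Continuous (gpoly n k β) := by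
  unfold gpoly
  fun_prop

theorem gpoly_zero_neg {n k : ℕ} (hkn : k < n) {β : ℝ} (hβ : 0 < β) : gpoly n k β 0 < 0 := by
  have hn : (0 : ℝ) < n := by exact_mod_cast (by omega : 0 < n)
  have h1 : (1 : ℝ) ≤ ∑ i ∈ Finset.Icc k (n - 1), (i.choose k : ℝ) * 0 ^ (i - k) := by
    have h := Finset.single_le_sum (s := Finset.Icc k (n - 1))
      (f := fun i => (i.choose k : ℝ) * 0 ^ (i - k)) (fun i _ => by positivity)
      (Finset.mem_Icc.2 ⟨le_rfl, by omega⟩)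
    simpa using h
  have h2 : (0 : ℝ) ≤ ∑ i ∈ Finset.Icc (n + 1) (4 * n), (i.choose k : ℝ) * 0 ^ (i - k) :=
    Finset.sum_nonneg fun i _ => by positivity
  have h3 : 0 < β / (2 * (n : ℝ)) := by positivity
  have h4 : 0 < β / (6 * (n : ℝ)) := by positivity
  rw [gpoly, zero_pow (by omega)]
  nlinarith [mul_le_mul_of_nonneg_left h1 h3.le, mul_nonneg h4.le h2]

theorem gpoly_pos {n k : ℕ} (hkn : k < n) {β : ℝ} (hβ0 : 0 < β) (hβ1 : β < 1) :
    0 < gpoly n k β (((n : ℝ) - k) / n) := by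
  have hn : (0 : ℝ) < n := by exact_mod_cast (by omega : 0 < n)
  have hkn' : (k : ℝ) < n := by exact_mod_cast hkn
  have ht0 : 0 < ((n : ℝ) - k) / n := div_pos (by linarith) hn
  have hW : 0 < (n.choose k : ℝ) * (((n : ℝ) - k) / n) ^ (n - k) :=
    mul_pos (by exact_mod_cast Nat.choose_pos hkn.le) (pow_pos ht0 _)
  have h1 := Finset.sum_le_card_nsmul (Finset.Icc k (n - 1))
    (fun i => (i.choose k : ℝ) * (((n : ℝ) - k) / n) ^ (i - k)) _
    fun i hi => choose_mul_pow_le hkn (Finset.mem_Icc.1 hi).1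
  have h2 := Finset.sum_le_card_nsmul (Finset.Icc (n + 1) (4 * n))
    (fun i => (i.choose k : ℝ) * (((n : ℝ) - k) / n) ^ (i - k)) _
    fun i hi => choose_mul_pow_le hkn (by have := (Finset.mem_Icc.1 hi).1; omega)
  rw [nsmul_eq_mul, Nat.card_Icc] at h1 h2
  unfold gpoly
  set W := (n.choose k : ℝ) * (((n : ℝ) - k) / n) ^ (n - k)
  have c1 : ((n - 1 + 1 - k : ℕ) : ℝ) ≤ n := by exact_mod_cast (by omega : n - 1 + 1 - k ≤ n)
  have c2 : ((4 * n + 1 - (n + 1) : ℕ) : ℝ) ≤ 3 * n := by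
    exact_mod_cast (by omega : 4 * n + 1 - (n + 1) ≤ 3 * n)
  have e1 := mul_le_mul_of_nonneg_left (h1.trans (mul_le_mul_of_nonneg_right c1 hW.le))
    (by positivity : 0 ≤ β / (2 * (n : ℝ)))
  have e2 := mul_le_mul_of_nonneg_left (h2.trans (mul_le_mul_of_nonneg_right c2 hW.le))
    (by positivity : 0 ≤ β / (6 * (n : ℝ)))
  have f1 : β / (2 * (n : ℝ)) * (n * W) = β * W / 2 := by field_simp
  have f2 : β / (6 * (n : ℝ)) * (3 * n * W) = β * W / 2 := by field_simp; ring
  rw [f1] at e1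
  rw [f2] at e2
  nlinarith

theorem gpoly_neg {n k : ℕ} (hkn : k < n) {β : ℝ} (hβ0 : 0 < β) (hβ1 : β < 1) :
    gpoly n k β (6 * n / β) < 0 := by
  have hn : (1 : ℝ) ≤ n := by exact_mod_cast (by omega : 1 ≤ n)
  have hT : 1 ≤ 6 * n / β := by rw [le_div_iff₀ hβ0]; linarith
  have hTβ : β / (6 * (n : ℝ)) * (6 * n / β) = 1 := by field_simp
  unfold gpoly
  set T : ℝ := 6 * n / β
  have hT0 : 0 < T := by linarith
  have h1 : 0 < ∑ i ∈ Finset.Icc k (n - 1), (i.choose k : ℝ) * T ^ (i - k) :=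
    Finset.sum_pos (fun i hi => mul_pos
      (by exact_mod_cast Nat.choose_pos (Finset.mem_Icc.1 hi).1) (pow_pos hT0 _))
      ⟨k, Finset.mem_Icc.2 ⟨le_rfl, by omega⟩⟩
  have h2 : ((4 * n).choose k : ℝ) * T ^ (4 * n - k)
      ≤ ∑ i ∈ Finset.Icc (n + 1) (4 * n), (i.choose k : ℝ) * T ^ (i - k) :=
    Finset.single_le_sum (f := fun i => (i.choose k : ℝ) * T ^ (i - k))
      (fun i _ => by positivity) (Finset.mem_Icc.2 ⟨by omega, le_rfl⟩)
  have h3 : (n.choose k : ℝ) * (T ^ (n - k) * T) ≤ ((4 * n).choose k : ℝ) * T ^ (4 * n - k) := by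
    rw [← pow_succ]
    gcongr
    · omega
    · omega
  have h4 := mul_le_mul_of_nonneg_left (h3.trans h2) (by positivity : 0 ≤ β / (6 * (n : ℝ)))
  have h5 : β / (6 * (n : ℝ)) * ((n.choose k : ℝ) * (T ^ (n - k) * T))
      = (n.choose k : ℝ) * T ^ (n - k) := by
    linear_combination (n.choose k : ℝ) * T ^ (n - k) * hTβ
  have h6 : 0 < β / (2 * (n : ℝ)) * ∑ i ∈ Finset.Icc k (n - 1), (i.choose k : ℝ) * T ^ (i - k) :=
    mul_pos (by positivity) h1
  linarith

/-- On the positive half-line, the roots of `gpoly` form a level set of a strictly convex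
function. -/
theorem exists_strictConvexOn_gpoly {n k : ℕ} (hkn : k < n) {β : ℝ} (hβ : 0 < β) :
    ∃ F : ℝ → ℝ, StrictConvexOn ℝ (Set.Ioi 0) F ∧
      ∀ t, 0 < t → gpoly n k β t = 0 → F t = n.choose k := by
  have hn : (0 : ℝ) < n := by exact_mod_cast (by omega : 0 < n)
  refine ⟨_, (strictConvexOn_sum_mul_zpow (Finset.Icc k (n - 1))
      (fun i => β / (2 * (n : ℝ)) * (i.choose k : ℝ)) (fun i => (i : ℤ) - n)
      (fun i _ => by positivity) (j := k) (Finset.mem_Icc.2 ⟨le_rfl, by omega⟩)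
      (by rw [Nat.choose_self]; positivity) (by omega) (by omega)).add_convexOn
    (convexOn_sum_mul_zpow (Finset.Icc (n + 1) (4 * n))
      (fun i => β / (6 * (n : ℝ)) * (i.choose k : ℝ)) (fun i => (i : ℤ) - n)
      (fun i _ => by positivity)), fun t ht h => ?_⟩
  have hpow (i : ℕ) (hi : k ≤ i) : t ^ (n - k) * t ^ ((i : ℤ) - n) = t ^ (i - k) := by
    rw [← zpow_natCast, ← zpow_natCast, ← zpow_add₀ ht.ne']
    congr 1
    omega
  have hsum (c : ℝ) (s : Finset ℕ) (hs : ∀ i ∈ s, k ≤ i) :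
      t ^ (n - k) * ∑ i ∈ s, c * (i.choose k : ℝ) * t ^ ((i : ℤ) - n)
        = c * ∑ i ∈ s, (i.choose k : ℝ) * t ^ (i - k) := by
    rw [Finset.mul_sum, Finset.mul_sum]
    refine Finset.sum_congr rfl fun i hi => ?_
    rw [← hpow i (hs i hi)]
    ring
  refine mul_left_cancel₀ (pow_pos ht (n - k)).ne' ?_
  simp only [Pi.add_apply]
  rw [mul_add, hsum _ _ fun i hi => (Finset.mem_Icc.1 hi).1,
    hsum _ _ fun i hi => by have := (Finset.mem_Icc.1 hi).1; omega]
  unfold gpoly at h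
  linarith

/-- for `n ≥ 1`, `k ∈ {0,…,n−1}` and `β ∈ (0,1)`, the polynomial `g` has
exactly two roots in `[0, +∞)`, denoted `t̲(k) ≤ t̄(k)`. -/
theorem stmt15 (n : ℕ) (hn : 1 ≤ n) (k : ℕ) (hk : k ≤ n - 1) (β : ℝ)
    (hβ0 : 0 < β) (hβ1 : β < 1) :
    ∃ t1 t2 : ℝ, 0 ≤ t1 ∧ t1 ≤ t2 ∧
      {t : ℝ | 0 ≤ t ∧ gpoly n k β t = 0} = {t1, t2} := by
  have hkn : k < n := by omega
  have hn1 : (1 : ℝ) ≤ n := by exact_mod_cast hn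
  have hkn' : (k : ℝ) < n := by exact_mod_cast hkn
  have hk0 : (0 : ℝ) ≤ k := Nat.cast_nonneg k
  have hcont := continuous_gpoly n k β
  have hneg0 := gpoly_zero_neg hkn hβ0
  have hpos := gpoly_pos hkn hβ0 hβ1
  have hnegT := gpoly_neg hkn hβ0 hβ1
  have hs0 : 0 < ((n : ℝ) - k) / n := div_pos (by linarith) (by linarith)
  have hsT : ((n : ℝ) - k) / n ≤ 6 * n / β :=
    ((div_le_one (by linarith)).2 (by linarith)).trans
      ((le_div_iff₀ hβ0).2 (by linarith))
  obtain ⟨t1, ⟨h01, h1s⟩, hg1⟩ := intermediate_value_Ioo hs0.le hcont.continuousOn ⟨hneg0, hpos⟩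
  obtain ⟨t2, ⟨hs2, -⟩, hg2⟩ := intermediate_value_Ioo' hsT hcont.continuousOn ⟨hnegT, hpos⟩
  have h12 : t1 < t2 := h1s.trans hs2
  have h02 : 0 < t2 := h01.trans h12
  obtain ⟨F, hF, hroot⟩ := exists_strictConvexOn_gpoly hkn hβ0
  refine ⟨t1, t2, h01.le, h12.le, Set.ext fun t => ⟨?_, ?_⟩⟩
  · rintro ⟨ht, hgt⟩
    have ht0 : 0 < t := ht.lt_of_ne (by rintro rfl; exact hneg0.ne hgt)
    have e := hroot t ht0 hgt
    have e1 := hroot t1 h01 hg1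
    have e2 := hroot t2 h02 hg2
    rcases lt_trichotomy t t1 with h | h | h
    · exact (hF.not_eq_of_lt_of_lt ht0 h02 h h12 e e1 e2).elim
    · exact Or.inl h
    · rcases lt_trichotomy t t2 with h' | h' | h'
      · exact (hF.not_eq_of_lt_of_lt h01 h02 h h' e1 e e2).elim
      · exact Or.inr h'
      · exact (hF.not_eq_of_lt_of_lt h01 ht0 h12 h' e1 e2 e).elim
  · rintro (rfl | rfl)
    · exact ⟨h01.le, hg1⟩
    · exact ⟨h02.le, hg2⟩
end
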